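/- arXiv:1910.12841 — 6 statements merged into one kernel-verified Lean document; each statement's English description precedes it below -/
import Mathlib

section
/- Let n ≥ 1 be a natural number, let m : {1,…,n} → ℕ satisfy m_i ≥ 1 for all i, let A be a nonempty finite set, and let f : A → ℕ^n be a map such that ∑_{i=1}^n i·f(a)_i = n for every a ∈ A and such that some a₀ ∈ A has f(a₀) = e_n (the vector with 1 in coordinate n and 0 elsewhere). For x > 0 and i ∈ {1,…,n} set λ_i(x) = m_i·x^i/i!, and let μ_x be the probability mass function on ℕ^n given by μ_x(z) = ∏_{i=1}^n e^{−λ_i(x)}·λ_i(x)^{z_i}/z_i! (the product of independent Poisson(λ_i(x)) distributions). Then there exists x₀ > 0 such that for all x > x₀ there is a function p : ℕ^n × A → ℝ with p ≥ 0, ∑_{a∈A} p(z,a) = μ_x(z) for every z ∈ ℕ^n, ∑_{z∈ℕ^n} p(z,a) = 1/|A| for every a ∈ A, and p(z,a) = 0 whenever ∑_{i=1}^n max(f(a)_i − z_i, 0) > 1. -/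
open MeasureTheory ProbabilityTheory Filter Topology

/-- The masses of the points of a set `s` add up to the measure of `s`. -/
theorem hasSum_indicator_measureReal_singleton {α : Type*} [MeasurableSpace α] [Countable α]
    [MeasurableSingletonClass α] (P : Measure α) [IsFiniteMeasure P] (s : Set α) :
    HasSum (s.indicator fun z => P.real {z}) (P.real s) := by
  have h := P.tsum_indicator_apply_singleton s s.to_countable.measurableSet
  have hfin : ∑' z, s.indicator (fun z => P {z}) z ≠ ⊤ := h ▸ measure_ne_top P s
  have key := ENNReal.hasSum_toReal hfin
  rw [← ENNReal.tsum_toReal_eq fun z => ENNReal.ne_top_of_tsum_ne_top hfin z, h] at key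
  rw [← measureReal_def] at key
  convert key using 2 with z
  by_cases hz : z ∈ s <;> simp [hz, Measure.real]

/-- If a probability mass function `q` gives mass more than `1 - 1 / |A|` to a set `s`, it can be
coupled with the uniform distribution on `A` so that every point outside `s` is sent to `a₀`. -/
theorem exists_coupling_uniform_of_large {Z A : Type*} [Fintype A] (a₀ : A)
    (q : Z → ℝ) (hq : ∀ z, 0 ≤ q z) (hq1 : HasSum q 1) (s : Set Z) (G : ℝ)
    (hG : HasSum (s.indicator q) G) (hlt : 1 - 1 / (Fintype.card A : ℝ) < G) :
    ∃ p : Z × A → ℝ, (∀ za, 0 ≤ p za) ∧ (∀ z, ∑ a, p (z, a) = q z) ∧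
      (∀ a, ∑' z, p (z, a) = 1 / (Fintype.card A : ℝ)) ∧
      ∀ z a, z ∉ s → a ≠ a₀ → p (z, a) = 0 := by
  classical
  have hcard : 0 < Fintype.card A := Fintype.card_pos_iff.mpr ⟨a₀⟩
  have hN : (1 : ℝ) ≤ Fintype.card A := by exact_mod_cast hcard
  set N : ℝ := (Fintype.card A : ℝ) with hNdef
  have hN0 : 0 < N := by linarith
  have hG0 : 0 < G := by
    have : 1 / N ≤ 1 := (div_le_one hN0).mpr hN
    linarith
  let e : A → ℝ := fun a => if a = a₀ then 1 else 0
  let w : A → ℝ := fun a => (1 / N - (1 - G) * e a) / G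
  have he : ∑ a, e a = 1 := by simp [e]
  have hw : ∑ a, w a = 1 := by
    have : ∑ a, (1 / N - (1 - G) * e a) = G := by
      rw [Finset.sum_sub_distrib, ← Finset.mul_sum, he, Finset.sum_const, Finset.card_univ,
        nsmul_eq_mul, ← hNdef]
      field_simp
      ring
    rw [← Finset.sum_div, this, div_self hG0.ne']
  have hw0 : ∀ a, 0 ≤ w a := by
    intro a
    refine div_nonneg ?_ hG0.le
    by_cases ha : a = a₀
    · simp only [e, ha, if_true]; linarith
    · simp only [e, ha, if_false]
      have := one_div_pos.mpr hN0
      linarith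
  refine ⟨fun za => s.indicator q za.1 * w za.2 + (q za.1 - s.indicator q za.1) * e za.2,
    ?_, ?_, ?_, ?_⟩
  · rintro ⟨z, a⟩
    have h1 : 0 ≤ s.indicator q z := Set.indicator_nonneg (fun z _ => hq z) z
    have h2 : s.indicator q z ≤ q z := Set.indicator_le_self' (fun z _ => hq z) z
    have h3 : 0 ≤ e a := by dsimp only [e]; split_ifs <;> norm_num
    exact add_nonneg (mul_nonneg h1 (hw0 a)) (mul_nonneg (sub_nonneg.mpr h2) h3)
  · intro z
    simp only [Finset.sum_add_distrib, ← Finset.mul_sum, he, hw]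
    ring
  · intro a
    rw [((hG.mul_right (w a)).add ((hq1.sub hG).mul_right (e a))).tsum_eq]
    dsimp only [w]
    field_simp
    ring
  · intro z a hz ha
    simp [e, hz, ha]

/-- As its rate grows, a Poisson variable exceeds any fixed level with probability tending
to `1`. -/
theorem tendsto_poissonMeasure_real_Ici (n : ℕ) :
    Tendsto (fun r : NNReal => (poissonMeasure r).real (Set.Ici n)) atTop (𝓝 1) := by
  have h : ∀ r : NNReal, (poissonMeasure r).real (Set.Ici n) =
      1 - ∑ k ∈ Finset.range n, (r : ℝ) ^ k * Real.exp (-r) / (k.factorial : ℝ) := by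
    intro r
    have hc : Set.Ici n = ((Finset.range n : Finset ℕ) : Set ℕ)ᶜ := by ext; simp
    rw [hc, probReal_compl_eq_one_sub (Finset.measurableSet _), ← sum_measureReal_singleton]
    simp only [poissonMeasure_real_singleton, mul_comm]
  simp only [h]
  have hsum : Tendsto (fun r : NNReal =>
      ∑ k ∈ Finset.range n, (r : ℝ) ^ k * Real.exp (-r) / (k.factorial : ℝ)) atTop (𝓝 0) := by
    rw [← Finset.sum_const_zero (s := Finset.range n) (ι := ℕ)]
    refine tendsto_finsetSum _ fun k _ => ?_
    have := ((Real.tendsto_pow_mul_exp_neg_atTop_nhds_zero k).comp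
      (NNReal.tendsto_coe_atTop.mpr tendsto_id)).div_const (k.factorial : ℝ)
    simpa [Function.comp_def] using this
  simpa using hsum.const_sub 1

/-- Theorem 1 of the paper in the assembly setting: there is a parameter threshold `x₀`
beyond which the product-Poisson distribution (with rates `mᵢ xⁱ / i!`) and the uniform
distribution on the assembly `A` admit a coupling assigning zero mass to all pivots. -/
theorem assembly_coupling
    (n : ℕ) (hn : 1 ≤ n) (m : Fin n → ℕ) (hm : ∀ i, 1 ≤ m i)
    (A : Type*) [Fintype A] [Nonempty A]
    (f : A → Fin n → ℕ)
    (hf : ∀ a, ∑ i : Fin n, ((i : ℕ) + 1) * f a i = n)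
    (a₀ : A) (ha₀ : f a₀ = fun i : Fin n => if (i : ℕ) + 1 = n then 1 else 0) :
    ∃ x₀ > (0 : ℝ), ∀ x > x₀,
      ∃ p : (Fin n → ℕ) × A → ℝ,
        (∀ za, 0 ≤ p za) ∧
        (∀ z : Fin n → ℕ, ∑ a : A, p (z, a) =
          ∏ i : Fin n,
            Real.exp (-((m i : ℝ) * x ^ ((i : ℕ) + 1) / (((i : ℕ) + 1).factorial : ℝ))) *
              ((m i : ℝ) * x ^ ((i : ℕ) + 1) / (((i : ℕ) + 1).factorial : ℝ)) ^ (z i) /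
                ((z i).factorial : ℝ)) ∧
        (∀ a : A, ∑' z : Fin n → ℕ, p (z, a) = 1 / (Fintype.card A : ℝ)) ∧
        (∀ z : Fin n → ℕ, ∀ a : A, 1 < ∑ i : Fin n, (f a i - z i) → p (z, a) = 0) := by
  have hpos : ∀ (i : Fin n) {x : ℝ}, 0 < x →
      0 ≤ (m i : ℝ) * x ^ ((i : ℕ) + 1) / (((i : ℕ) + 1).factorial : ℝ) :=
    fun i x hx => by positivity
  let r : Fin n → ℝ → NNReal := fun i x =>
    ((m i : ℝ) * x ^ ((i : ℕ) + 1) / (((i : ℕ) + 1).factorial : ℝ)).toNNReal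
  have hr : ∀ i, Tendsto (r i) atTop atTop := fun i => by
    refine tendsto_real_toNNReal_atTop.comp (Tendsto.atTop_div_const (by positivity) ?_)
    exact (tendsto_pow_atTop (Nat.succ_ne_zero _)).const_mul_atTop
      (by exact_mod_cast hm i)
  have hG : Tendsto (fun x => ∏ i, (poissonMeasure (r i x)).real (Set.Ici n)) atTop (𝓝 1) := by
    simpa using tendsto_finsetProd Finset.univ
      fun i _ => (tendsto_poissonMeasure_real_Ici n).comp (hr i)
  have hN : 1 - 1 / (Fintype.card A : ℝ) < 1 := by
    have : (0 : ℝ) < Fintype.card A := by exact_mod_cast Fintype.card_pos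
    have := one_div_pos.mpr this
    linarith
  obtain ⟨x₁, hx₁⟩ := eventually_atTop.mp (hG.eventually (lt_mem_nhds hN))
  refine ⟨max x₁ 1, by positivity, fun x hx => ?_⟩
  have hx0 : 0 < x := lt_trans (by positivity) hx
  let P : Measure (Fin n → ℕ) := Measure.pi fun i => poissonMeasure (r i x)
  have hrect : ∀ t : Fin n → Set ℕ,
      P.real (Set.univ.pi t) = ∏ i, (poissonMeasure (r i x)).real (t i) := fun t => by
    simp [P, Measure.real, Measure.pi_pi, ENNReal.toReal_prod]
  obtain ⟨p, hp0, hpz, hpa, hps⟩ := exists_coupling_uniform_of_large a₀ (fun z => P.real {z})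
    (fun _ => measureReal_nonneg)
    (by simpa using hasSum_indicator_measureReal_singleton P Set.univ)
    (Set.univ.pi fun _ => Set.Ici n) _ (hasSum_indicator_measureReal_singleton P _)
    (by rw [hrect]; exact hx₁ x ((le_max_left _ _).trans hx.le))
  refine ⟨p, hp0, fun z => ?_, hpa, fun z a hza => hps z a ?_ ?_⟩
  · rw [hpz, ← Set.univ_pi_singleton, hrect]
    refine Finset.prod_congr rfl fun i _ => ?_
    rw [poissonMeasure_real_singleton, Real.coe_toNNReal _ (hpos i hx0)]
  · intro hz
    have hle : ∀ i, f a i - z i = 0 := fun i => by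
      have h1 : n ≤ z i := hz i trivial
      have h2 : ((i : ℕ) + 1) * f a i ≤ n :=
        (Finset.single_le_sum (f := fun i : Fin n => ((i : ℕ) + 1) * f a i)
          (fun _ _ => Nat.zero_le _) (Finset.mem_univ i)).trans_eq (hf a)
      have h3 : f a i ≤ ((i : ℕ) + 1) * f a i := Nat.le_mul_of_pos_left _ (Nat.succ_pos _)
      omega
    simp [hle] at hza
  · rintro rfl
    have hle : ∑ i, (f a i - z i) ≤ ∑ i, f a i := Finset.sum_le_sum fun i _ => Nat.sub_le _ _
    have hone : ∑ i, f a i ≤ 1 := by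
      have hlast : ∀ i : Fin n, (i : ℕ) + 1 = n ↔ i = ⟨n - 1, by omega⟩ := fun i => by
        rw [Fin.ext_iff]; dsimp only; omega
      simp [ha₀, hlast]
    omega
end

section
/- Let n ≥ 1 be a natural number, let m : {1,…,n} → ℕ satisfy m_i ≥ 1 for all i, let A be a nonempty finite set, and let f : A → ℕ^n be a map such that ∑_{i=1}^n i·f(a)_i = n for every a ∈ A and such that some a₀ ∈ A has f(a₀) = e_n (the vector with 1 in coordinate n and 0 elsewhere). For x ∈ (0,1) and i ∈ {1,…,n}, let ν_x be the probability mass function on ℕ^n given by ν_x(z) = ∏_{i=1}^n binom(z_i + m_i − 1, z_i)·x^{i·z_i}·(1 − x^i)^{m_i} (the product of independent negative binomial NB(m_i, x^i) distributions). Then there exists x₀ ∈ (0,1) such that for all x with x₀ < x < 1 there is a function p : ℕ^n × A → ℝ with p ≥ 0, ∑_{a∈A} p(z,a) = ν_x(z) for every z ∈ ℕ^n, ∑_{z∈ℕ^n} p(z,a) = 1/|A| for every a ∈ A, and p(z,a) = 0 whenever ∑_{i=1}^n max(f(a)_i − z_i, 0) > 1. -/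
open scoped BigOperators

/-- A product of finitely many nonnegative summable families sums to the product of the sums. -/
theorem HasSum.pi_prod_of_nonneg {ι : Type*} {n : ℕ} {g : Fin n → ι → ℝ} {s : Fin n → ℝ}
    (hg : ∀ i k, 0 ≤ g i k) (hs : ∀ i, HasSum (g i) (s i)) :
    HasSum (fun z : Fin n → ι => ∏ i, g i (z i)) (∏ i, s i) := by
  induction n with
  | zero => simp
  | succ n ih =>
    have tail := ih (fun i : Fin n => hg i.succ) (fun i => hs i.succ)
    have tail_nonneg : 0 ≤ fun z : Fin n → ι => ∏ i, g i.succ (z i) :=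
      fun z => Finset.prod_nonneg fun i _ => hg i.succ (z i)
    have head_nonneg : 0 ≤ g 0 := fun k => hg 0 k
    have summable_mul : Summable fun x : ι × (Fin n → ι) => g 0 x.1 * ∏ i, g i.succ (x.2 i) := by
      apply Summable.mul_of_nonneg (hs 0).summable tail.summable head_nonneg tail_nonneg
    have key := (hs 0).mul tail summable_mul
    rw [← (Fin.consEquiv fun _ : Fin (n + 1) => ι).hasSum_iff, Fin.prod_univ_succ]
    refine key.congr_fun fun z => ?_
    simp [Fin.prod_univ_succ, Fin.consEquiv]

/-- The negative binomial mass function with `m` successes and parameter `r`. -/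
noncomputable def negBinomialMass (m : ℕ) (r : ℝ) (k : ℕ) : ℝ :=
  ((k + m - 1).choose k : ℝ) * r ^ k * (1 - r) ^ m

theorem negBinomialMass_nonneg (m : ℕ) {r : ℝ} (h0 : 0 ≤ r) (h1 : r ≤ 1) (k : ℕ) :
    0 ≤ negBinomialMass m r k := by
  have : 0 ≤ 1 - r := by linarith
  unfold negBinomialMass
  positivity

theorem hasSum_negBinomialMass {m : ℕ} (hm : 1 ≤ m) {r : ℝ} (h0 : 0 ≤ r) (h1 : r < 1) :
    HasSum (negBinomialMass m r) 1 := by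
  obtain ⟨j, rfl⟩ := Nat.exists_eq_add_of_le' hm
  have h := (hasSum_choose_mul_geometric_of_norm_lt_one j (r := r)
    (by rwa [Real.norm_of_nonneg h0])).mul_right ((1 - r) ^ (j + 1))
  rw [one_div_mul_cancel (pow_ne_zero _ (by linarith))] at h
  refine h.congr_fun fun k => ?_
  rw [negBinomialMass, ← add_assoc, Nat.add_sub_cancel, Nat.choose_symm_add]

theorem HasSum.tail_indicator {g : ℕ → ℝ} {s : ℝ} (h : HasSum g s) (N : ℕ) :
    HasSum (fun k => if N ≤ k then g k else 0) (s - ∑ k ∈ Finset.range N, g k) := by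
  have hfin : HasSum (fun k => if k < N then g k else 0) (∑ k ∈ Finset.range N, g k) := by
    have := hasSum_sum_of_ne_finset_zero (L := .unconditional ℕ) (f := fun k => if k < N then g k else 0)
      (s := Finset.range N) (fun k hk => if_neg (by simpa using hk))
    rwa [Finset.sum_congr rfl fun k hk => if_pos (Finset.mem_range.mp hk)] at this
  refine (h.sub hfin).congr_fun fun k => ?_
  by_cases hk : N ≤ k
  · simp [hk, not_lt.mpr hk]
  · simp [hk, not_le.mp hk]

/-- If `a₀` is compatible with every point and all elements are compatible with every point of `G`,
then a probability mass function `ν` giving `G` enough mass couples with the uniform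
distribution so that only compatible pairs are charged. -/
theorem exists_coupling_uniform_of_mass_le {Z A : Type*} [Fintype A]
    {ν : Z → ℝ} (hν : ∀ z, 0 ≤ ν z) (hν_sum : HasSum ν 1) (G : Set Z) {q : ℝ} (hq : 0 < q)
    (hG : HasSum (G.indicator ν) q) (hq_card : 1 - 1 / (Fintype.card A : ℝ) ≤ q)
    (R : Z → A → Prop) (a₀ : A) (ha₀ : ∀ z, R z a₀) (hR : ∀ z ∈ G, ∀ a, R z a) :
    ∃ p : Z × A → ℝ, (∀ za, 0 ≤ p za) ∧ (∀ z, ∑ a, p (z, a) = ν z) ∧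
      (∀ a, ∑' z, p (z, a) = 1 / (Fintype.card A : ℝ)) ∧ ∀ z a, ¬ R z a → p (z, a) = 0 := by
  classical
  have hcard : (Fintype.card A : ℝ) ≠ 0 := by
    have : Nonempty A := ⟨a₀⟩
    exact_mod_cast Fintype.card_ne_zero
  have hcompl : HasSum (Gᶜ.indicator ν) (1 - q) := by
    simpa [Set.indicator_compl, Pi.sub_def] using hν_sum.sub hG
  have hq_le : q ≤ 1 := by
    have := hcompl.nonneg fun z => Set.indicator_nonneg (fun z _ => hν z) z
    linarith
  set c : A → ℝ := fun a => (1 / (Fintype.card A : ℝ) - if a = a₀ then 1 - q else 0) / q with hc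
  refine ⟨fun za => G.indicator ν za.1 * c za.2 +
    Gᶜ.indicator ν za.1 * (if za.2 = a₀ then 1 else 0), ?_, ?_, ?_, ?_⟩
  · rintro ⟨z, a⟩
    have hca : 0 ≤ c a := by
      refine div_nonneg ?_ hq.le
      split_ifs
      · linarith
      · simp
    refine add_nonneg (mul_nonneg (Set.indicator_nonneg (fun z _ => hν z) z) hca)
      (mul_nonneg (Set.indicator_nonneg (fun z _ => hν z) z) ?_)
    split_ifs <;> norm_num
  · intro z
    have hsum : ∑ a, c a = 1 := by
      simp only [hc, ← Finset.sum_div, Finset.sum_sub_distrib]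
      simp [hcard, hq.ne']
    simp only [Finset.sum_add_distrib, ← Finset.mul_sum, hsum]
    simp
  · intro a
    rw [((hG.mul_right (c a)).add (hcompl.mul_right (if a = a₀ then 1 else 0))).tsum_eq]
    simp only [hc]
    rw [mul_div_cancel₀ _ hq.ne']
    split_ifs <;> ring
  · intro z a hza
    have hz : z ∉ G := fun h => hza (hR z h a)
    have ha : a ≠ a₀ := fun h => hza (h ▸ ha₀ z)
    simp [hz, ha]

/-- Theorem 1 of the paper in the multiset setting: there is a threshold `x₀ ∈ (0,1)`
beyond which the product negative-binomial distribution `NB(mᵢ, xⁱ)` and the uniform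
distribution on the multiset structure `A` admit a coupling assigning zero mass to all pivots. -/
theorem multiset_coupling
    (n : ℕ) (hn : 1 ≤ n) (m : Fin n → ℕ) (hm : ∀ i, 1 ≤ m i)
    (A : Type*) [Fintype A] [Nonempty A]
    (f : A → Fin n → ℕ)
    (hf : ∀ a, ∑ i : Fin n, ((i : ℕ) + 1) * f a i = n)
    (a₀ : A) (ha₀ : f a₀ = fun i : Fin n => if (i : ℕ) + 1 = n then 1 else 0) :
    ∃ x₀ ∈ Set.Ioo (0 : ℝ) 1, ∀ x, x₀ < x → x < 1 →
      ∃ p : (Fin n → ℕ) × A → ℝ,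
        (∀ za, 0 ≤ p za) ∧
        (∀ z : Fin n → ℕ, ∑ a : A, p (z, a) =
          ∏ i : Fin n,
            ((z i + m i - 1).choose (z i) : ℝ) * x ^ (((i : ℕ) + 1) * z i) *
              (1 - x ^ ((i : ℕ) + 1)) ^ (m i)) ∧
        (∀ a : A, ∑' z : Fin n → ℕ, p (z, a) = 1 / (Fintype.card A : ℝ)) ∧
        (∀ z : Fin n → ℕ, ∀ a : A, 1 < ∑ i : Fin n, (f a i - z i) → p (z, a) = 0) := by
  have hcard : 0 < 1 / (Fintype.card A : ℝ) := by positivity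
  have hF : Continuous fun x : ℝ => ∏ i : Fin n,
      (1 - ∑ k ∈ Finset.range n, negBinomialMass (m i) (x ^ ((i : ℕ) + 1)) k) := by
    unfold negBinomialMass
    fun_prop
  have hF1 : (∏ i : Fin n,
      (1 - ∑ k ∈ Finset.range n, negBinomialMass (m i) ((1 : ℝ) ^ ((i : ℕ) + 1)) k)) = 1 :=
    Finset.prod_eq_one fun i _ => by
      simp [negBinomialMass, (Nat.one_le_iff_ne_zero.mp (hm i))]
  have hev := (hF.continuousAt (x := 1)).eventually
    (lt_mem_nhds (a := max 0 (1 - 1 / (Fintype.card A : ℝ)))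
      (by simp only [hF1]; exact max_lt one_pos (by linarith)))
  obtain ⟨l, hl, hl'⟩ := exists_Ioc_subset_of_mem_nhds hev ⟨0, one_pos⟩
  refine ⟨max l (1 / 2), ⟨by positivity, max_lt hl (by norm_num)⟩, fun x hx hx1 => ?_⟩
  have hx0 : 0 < x := lt_of_lt_of_le (by norm_num) ((le_max_right l (1 / 2)).trans hx.le)
  have hx_mem := hl' ⟨(le_max_left _ _).trans_lt hx, hx1.le⟩
  simp only [Set.mem_ofPred_eq, max_lt_iff] at hx_mem
  obtain ⟨hq, hq_card⟩ := hx_mem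
  have hnonneg : ∀ (i : Fin n) (k : ℕ), 0 ≤ negBinomialMass (m i) (x ^ ((i : ℕ) + 1)) k :=
    fun i => negBinomialMass_nonneg (m i) (by positivity) (pow_le_one₀ hx0.le hx1.le)
  have hsum : ∀ i : Fin n, HasSum (negBinomialMass (m i) (x ^ ((i : ℕ) + 1))) 1 :=
    fun i => hasSum_negBinomialMass (hm i) (by positivity)
      (pow_lt_one₀ hx0.le hx1 (Nat.succ_ne_zero _))
  have hf_le : ∀ a i, f a i ≤ n := fun a i =>
    calc f a i ≤ ((i : ℕ) + 1) * f a i := Nat.le_mul_of_pos_left _ (Nat.succ_pos _)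
      _ ≤ ∑ j : Fin n, ((j : ℕ) + 1) * f a j :=
        Finset.single_le_sum (f := fun j : Fin n => ((j : ℕ) + 1) * f a j)
          (fun _ _ => Nat.zero_le _) (Finset.mem_univ i)
      _ = n := hf a
  have htail := HasSum.pi_prod_of_nonneg (fun i k => ite_nonneg (p := n ≤ k) (hnonneg i k) le_rfl)
    (fun i => (hsum i).tail_indicator n)
  obtain ⟨p, hp, hp_left, hp_right, hp_pivot⟩ := exists_coupling_uniform_of_mass_le
    (ν := fun z : Fin n → ℕ => ∏ i, negBinomialMass (m i) (x ^ ((i : ℕ) + 1)) (z i))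
    (fun z => Finset.prod_nonneg fun i _ => hnonneg i (z i))
    (by simpa using HasSum.pi_prod_of_nonneg hnonneg hsum)
    {z | ∀ i, n ≤ z i} hq
    (htail.congr_fun fun z => by
      classical
      rw [Finset.prod_ite_zero]
      simp [Set.indicator_apply])
    hq_card.le (fun z a => ∑ i : Fin n, (f a i - z i) ≤ 1) a₀
    (fun z => by
      refine (Finset.sum_le_sum fun i _ => Nat.sub_le (f a₀ i) (z i)).trans ?_
      rw [ha₀, ← Finset.card_filter, Finset.card_le_one]
      intro i hi j hj
      simp only [Finset.mem_filter] at hi hj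
      exact Fin.ext (by omega))
    (fun z hz a => by
      simp [Nat.sub_eq_zero_of_le ((hf_le a _).trans (hz _))])
  refine ⟨p, hp, fun z => ?_, hp_right, fun z a h => hp_pivot z a (not_le.mpr h)⟩
  simp only [hp_left, negBinomialMass, pow_mul]
end

section
/- Let n ≥ 1 be a natural number, let m : {1,…,n} → ℕ satisfy m_i ≥ 1 for all i, let A be a nonempty finite set, and let f : A → ℕ^n be a map such that for every a ∈ A one has ∑_{i=1}^n i·f(a)_i = n and f(a)_i ≤ m_i for all i, and such that some a₀ ∈ A has f(a₀) = e_n (the vector with 1 in coordinate n and 0 elsewhere). For x > 0 set p_i(x) = x^i/(1 + x^i), and let β_x be the probability mass function on ℕ^n given by β_x(z) = ∏_{i=1}^n binom(m_i, z_i)·p_i(x)^{z_i}·(1 − p_i(x))^{m_i − z_i} when z_i ≤ m_i for all i, and β_x(z) = 0 otherwise (the product of independent Binomial(m_i, p_i(x)) distributions). Then there exists x₀ > 0 such that for all x > x₀ there is a function p : ℕ^n × A → ℝ with p ≥ 0, ∑_{a∈A} p(z,a) = β_x(z) for every z ∈ ℕ^n, ∑_{z∈ℕ^n} p(z,a) =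 1/|A| for every a ∈ A, and p(z,a) = 0 whenever ∑_{i=1}^n max(f(a)_i − z_i, 0) > 1. -/
open scoped BigOperators

/-- A distribution `B` whose mass outside the point `z₀` is at most `1 / |A|` can be coupled with
the uniform distribution on `A` so that every `z ≠ z₀` is matched with `a₀` only. -/
theorem exists_coupling_uniform_of_concentrated {Z A : Type*} [Fintype A] [Nonempty A]
    (B : Z → ℝ) (hB : ∀ z, 0 ≤ B z) (hsum : HasSum B 1) (z₀ : Z) (a₀ : A)
    (hz₀ : 1 - B z₀ ≤ 1 / (Fintype.card A : ℝ)) :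
    ∃ p : Z × A → ℝ,
      (∀ za, 0 ≤ p za) ∧
      (∀ z, ∑ a, p (z, a) = B z) ∧
      (∀ a, ∑' z, p (z, a) = 1 / (Fintype.card A : ℝ)) ∧
      (∀ z a, z ≠ z₀ → a ≠ a₀ → p (z, a) = 0) := by
  classical
  have hN : (0 : ℝ) < Fintype.card A := by exact_mod_cast Fintype.card_pos
  refine ⟨fun za => (if za.1 = z₀ then 1 / (Fintype.card A : ℝ) else 0) +
    (if za.2 = a₀ then B za.1 - (if za.1 = z₀ then 1 else 0) else 0), ?_, ?_, ?_, ?_⟩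
  · rintro ⟨z, a⟩
    have := hB z
    have : 0 ≤ 1 / (Fintype.card A : ℝ) := by positivity
    dsimp only
    split_ifs with hz ha
    · subst hz
      linarith
    all_goals linarith
  · intro z
    rw [Finset.sum_add_distrib]
    by_cases hz : z = z₀
    · simp [hz, hN.ne']
    · simp [hz]
  · intro a
    have hpoint (c : ℝ) : HasSum (fun z => if z = z₀ then c else 0) c := hasSum_ite_eq z₀ c
    by_cases ha : a = a₀
    · simpa [ha] using ((hpoint (1 / Fintype.card A)).add (hsum.sub (hpoint 1))).tsum_eq
    · simp [ha]
  · intro z a hz ha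
    simp [hz, ha]

/-- The total mass of a product of independent binomial distributions is `1`. -/
theorem hasSum_prod_binomial {ι : Type*} [Fintype ι] (m : ι → ℕ) (q : ι → ℝ)
    [DecidablePred fun z : ι → ℕ => ∀ i, z i ≤ m i] :
    HasSum (fun z : ι → ℕ => if ∀ i, z i ≤ m i then
      ∏ i, ((m i).choose (z i) : ℝ) * q i ^ z i * (1 - q i) ^ (m i - z i) else 0) 1 := by
  classical
  let s : Finset (ι → ℕ) := Fintype.piFinset fun i => Finset.range (m i + 1)
  have hs (z : ι → ℕ) : z ∈ s ↔ ∀ i, z i ≤ m i := by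
    simp only [s, Fintype.mem_piFinset, Finset.mem_range, Nat.lt_succ_iff]
  have htotal : ∑ z ∈ s, ∏ i, ((m i).choose (z i) : ℝ) * q i ^ z i * (1 - q i) ^ (m i - z i)
      = 1 := by
    rw [← Finset.prod_univ_sum (fun i => Finset.range (m i + 1))
      (fun i k => ((m i).choose k : ℝ) * q i ^ k * (1 - q i) ^ (m i - k))]
    refine Finset.prod_eq_one fun i _ => ?_
    have h := add_pow (q i) (1 - q i) (m i)
    rw [add_sub_cancel, one_pow] at h
    exact (Finset.sum_congr rfl fun k _ => by ring).trans h.symm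
  have hsum := hasSum_sum_of_ne_finset_zero (L := .unconditional _) (s := s) (f := fun z : ι → ℕ =>
    if ∀ i, z i ≤ m i then
      ∏ i, ((m i).choose (z i) : ℝ) * q i ^ z i * (1 - q i) ^ (m i - z i) else 0)
    fun z hz => if_neg fun h => hz ((hs z).2 h)
  rwa [Finset.sum_congr rfl fun z hz => if_pos ((hs z).1 hz), htotal] at hsum

theorem tendsto_pow_div_one_add_pow_atTop {k : ℕ} (hk : k ≠ 0) :
    Filter.Tendsto (fun x : ℝ => x ^ k / (1 + x ^ k)) Filter.atTop (nhds 1) := by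
  have h : Filter.Tendsto (fun x : ℝ => 1 - (1 + x ^ k)⁻¹) Filter.atTop (nhds (1 - 0)) :=
    (Filter.tendsto_atTop_add_const_left _ 1
      (Filter.tendsto_pow_atTop hk)).inv_tendsto_atTop.const_sub 1
  rw [sub_zero] at h
  refine h.congr' ?_
  filter_upwards [Filter.eventually_gt_atTop 0] with x hx
  have : 1 + x ^ k ≠ 0 := by positivity
  field_simp
  ring

/-- Theorem 1 of the paper in the selection setting: there is a threshold `x₀ > 0`
beyond which the product binomial distribution `Bin(mᵢ, xⁱ/(1+xⁱ))` and the uniform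
distribution on the selection structure `A` admit a coupling assigning zero mass to all pivots. -/
theorem selection_coupling
    (n : ℕ) (hn : 1 ≤ n) (m : Fin n → ℕ) (hm : ∀ i, 1 ≤ m i)
    (A : Type*) [Fintype A] [Nonempty A]
    (f : A → Fin n → ℕ)
    (hf : ∀ a, (∑ i : Fin n, ((i : ℕ) + 1) * f a i = n) ∧ ∀ i, f a i ≤ m i)
    (a₀ : A) (ha₀ : f a₀ = fun i : Fin n => if (i : ℕ) + 1 = n then 1 else 0) :
    ∃ x₀ > (0 : ℝ), ∀ x > x₀,
      ∃ p : (Fin n → ℕ) × A → ℝ,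
        (∀ za, 0 ≤ p za) ∧
        (∀ z : Fin n → ℕ, ∑ a : A, p (z, a) =
          if ∀ i, z i ≤ m i then
            ∏ i : Fin n,
              ((m i).choose (z i) : ℝ) * (x ^ ((i : ℕ) + 1) / (1 + x ^ ((i : ℕ) + 1))) ^ (z i) *
                (1 - x ^ ((i : ℕ) + 1) / (1 + x ^ ((i : ℕ) + 1))) ^ (m i - z i)
          else 0) ∧
        (∀ a : A, ∑' z : Fin n → ℕ, p (z, a) = 1 / (Fintype.card A : ℝ)) ∧
        (∀ z : Fin n → ℕ, ∀ a : A, 1 < ∑ i : Fin n, (f a i - z i) → p (z, a) = 0) := by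
  have hN : (0 : ℝ) < Fintype.card A := by exact_mod_cast Fintype.card_pos
  have hlim : Filter.Tendsto (fun x : ℝ => ∏ i : Fin n,
      (x ^ ((i : ℕ) + 1) / (1 + x ^ ((i : ℕ) + 1))) ^ m i) Filter.atTop (nhds 1) := by
    simpa using tendsto_finsetProd (Finset.univ : Finset (Fin n)) fun i _ =>
      (tendsto_pow_div_one_add_pow_atTop (Nat.succ_ne_zero (i : ℕ))).pow (m i)
  obtain ⟨x₁, hx₁⟩ := Filter.eventually_atTop.1 (hlim.eventually_const_lt
    (sub_lt_self (1 : ℝ) (one_div_pos.2 hN)))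
  refine ⟨max x₁ 1, by positivity, fun x hx => ?_⟩
  have hx0 : 0 < x := zero_lt_one.trans ((le_max_right x₁ 1).trans_lt hx)
  have hmass := hx₁ x ((le_max_left x₁ 1).trans hx.le)
  obtain ⟨p, hp, hrow, hcol, hzero⟩ := exists_coupling_uniform_of_concentrated _ (fun z => by
      split_ifs
      · refine Finset.prod_nonneg fun i _ => ?_
        have : 0 ≤ 1 - x ^ ((i : ℕ) + 1) / (1 + x ^ ((i : ℕ) + 1)) :=
          sub_nonneg.2 (div_le_one_of_le₀ (by linarith) (by positivity))
        positivity
      · exact le_rfl)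
    (hasSum_prod_binomial m fun i : Fin n => x ^ ((i : ℕ) + 1) / (1 + x ^ ((i : ℕ) + 1)))
    m a₀ (by
      simp only [le_refl, implies_true, if_true, Nat.choose_self, Nat.cast_one, one_mul,
        Nat.sub_self, pow_zero, mul_one]
      linarith)
  refine ⟨p, hp, hrow, hcol, fun z a hza => hzero z a ?_ ?_⟩
  · rintro rfl
    simp [Nat.sub_eq_zero_of_le ((hf a).2 _)] at hza
  · rintro rfl
    refine hza.not_ge ?_
    calc ∑ i, (f a i - z i) ≤ ∑ i, f a i := Finset.sum_le_sum fun i _ => Nat.sub_le _ _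
      _ = ∑ i : Fin n, if i = ⟨n - 1, by omega⟩ then 1 else 0 := by
          rw [ha₀]
          refine Finset.sum_congr rfl fun i _ => if_congr ?_ rfl rfl
          rw [Fin.ext_iff]
          change _ ↔ (i : ℕ) = n - 1
          omega
      _ ≤ 1 := by simp
end

section
/- Let n ≥ 1, let m : {1,…,n} → ℕ satisfy m_i ≥ 1 for all i, and let C ∈ ℕ^n satisfy ∑_{i=1}^n i·C_i = n. For x > 0 set λ_i(x) = m_i·x^i/i! and define PM(x) = ∑_{z ∈ ℕ^n : ∑_i max(C_i − z_i, 0) > 1} ∏_{i=1}^n e^{−λ_i(x)}·λ_i(x)^{z_i}/z_i!. Then PM(x) → 0 as x → ∞. -/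
open scoped BigOperators
open Filter

/-- Union bound for product mass functions: if every point satisfying `P` has a coordinate `j`
below `C j`, then the product mass of `P` is at most the sum of the marginal masses of the events
`z j < C j`. -/
theorem tsum_prod_le_sum_sum_range {ι : Type*} [Fintype ι] (p : ι → ℕ → ℝ)
    (hp : ∀ i k, 0 ≤ p i k) (hp1 : ∀ i (s : Finset ℕ), ∑ k ∈ s, p i k ≤ 1) (C : ι → ℕ)
    (P : (ι → ℕ) → Prop) (hP : ∀ z, P z → ∃ j, z j < C j) :
    ∑' z : {z : ι → ℕ // P z}, ∏ i, p i (z.1 i) ≤ ∑ j, ∑ k ∈ Finset.range (C j), p j k := by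
  classical
  have hprod : ∀ z : ι → ℕ, 0 ≤ ∏ i, p i (z i) := fun z => Finset.prod_nonneg fun i _ => hp i _
  refine Real.tsum_le_of_sum_le (fun z => hprod z.1) fun s => ?_
  calc
    ∑ z ∈ s, ∏ i, p i (z.1 i)
        ≤ ∑ z ∈ s, ∑ j, if z.1 j < C j then ∏ i, p i (z.1 i) else 0 := by
      refine Finset.sum_le_sum fun z _ => ?_
      obtain ⟨j, hj⟩ := hP z.1 z.2
      refine le_trans (if_pos hj).ge (Finset.single_le_sum
        (f := fun j => if z.1 j < C j then ∏ i, p i (z.1 i) else 0) (fun i _ => ?_)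
        (Finset.mem_univ j))
      split_ifs
      exacts [hprod _, le_rfl]
    _ = ∑ j, ∑ z ∈ (s.map (Function.Embedding.subtype P)).filter (fun z => z j < C j),
          ∏ i, p i (z i) := by
      rw [Finset.sum_comm]
      refine Finset.sum_congr rfl fun j _ => ?_
      rw [Finset.sum_filter, Finset.sum_map]
      rfl
    _ ≤ ∑ j, ∑ k ∈ Finset.range (C j), p j k := by
      refine Finset.sum_le_sum fun j _ => ?_
      let A : ι → Finset ℕ := Function.update
        (fun i => s.image fun z => z.1 i) j (Finset.range (C j))
      calc
        _ ≤ ∑ z ∈ Fintype.piFinset A, ∏ i, p i (z i) := by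
          refine Finset.sum_le_sum_of_subset_of_nonneg (fun z hz => ?_) fun z _ _ => hprod z
          simp only [Finset.mem_filter, Finset.mem_map] at hz
          obtain ⟨⟨w, hw, rfl⟩, hj⟩ := hz
          refine Fintype.mem_piFinset.2 fun i => ?_
          rcases eq_or_ne i j with rfl | hij
          · simpa [A] using hj
          · simp only [A, Function.update_of_ne hij]
            exact Finset.mem_image_of_mem (fun z : {z // P z} => z.1 i) hw
        _ = ∏ i, ∑ k ∈ A i, p i k := (Finset.prod_univ_sum A p).symm
        _ = (∑ k ∈ A j, p j k) * ∏ i ∈ Finset.univ.erase j, ∑ k ∈ A i, p i k :=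
          (Finset.mul_prod_erase _ _ (Finset.mem_univ j)).symm
        _ ≤ ∑ k ∈ A j, p j k :=
          mul_le_of_le_one_right (Finset.sum_nonneg fun k _ => hp j k)
            (Finset.prod_le_one (fun i _ => Finset.sum_nonneg fun k _ => hp i k)
              fun i _ => hp1 i _)
        _ = ∑ k ∈ Finset.range (C j), p j k := by simp [A]

theorem sum_exp_neg_mul_pow_div_factorial_le_one {r : ℝ} (hr : 0 ≤ r) (s : Finset ℕ) :
    ∑ k ∈ s, Real.exp (-r) * r ^ k / (k.factorial : ℝ) ≤ 1 := by
  have h : HasSum (fun k : ℕ => r ^ k / (k.factorial : ℝ)) (Real.exp r) := by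
    rw [Real.exp_eq_exp_ℝ]
    exact NormedSpace.expSeries_div_hasSum_exp r
  calc
    _ = Real.exp (-r) * ∑ k ∈ s, r ^ k / (k.factorial : ℝ) := by
      simp only [Finset.mul_sum, mul_div_assoc]
    _ ≤ Real.exp (-r) * Real.exp r := by
      gcongr
      exact sum_le_hasSum s (fun k _ => by positivity) h
    _ = 1 := by rw [← Real.exp_add, neg_add_cancel, Real.exp_zero]

theorem tendsto_exp_neg_mul_pow_div_factorial_atTop (k : ℕ) :
    Tendsto (fun r : ℝ => Real.exp (-r) * r ^ k / (k.factorial : ℝ)) atTop (nhds 0) := by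
  simpa [mul_comm] using
    (Real.tendsto_pow_mul_exp_neg_atTop_nhds_zero k).div_const (k.factorial : ℝ)

/-- Verification of condition (6) of the paper for assemblies: with `Zᵢ` independent
Poisson(`mᵢ xⁱ / i!`), the pivot mass of a column label `C` (the product-Poisson mass of
the set of pivot rows) tends to `0` as `x → ∞`. -/
theorem assembly_pivot_mass_tendsto_zero
    (n : ℕ) (hn : 1 ≤ n) (m : Fin n → ℕ) (hm : ∀ i, 1 ≤ m i)
    (C : Fin n → ℕ) (hC : ∑ i : Fin n, ((i : ℕ) + 1) * C i = n) :
    Tendsto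
      (fun x : ℝ =>
        ∑' z : {z : Fin n → ℕ // 1 < ∑ i : Fin n, (C i - z i)},
          ∏ i : Fin n,
            Real.exp (-((m i : ℝ) * x ^ ((i : ℕ) + 1) / (((i : ℕ) + 1).factorial : ℝ))) *
              ((m i : ℝ) * x ^ ((i : ℕ) + 1) / (((i : ℕ) + 1).factorial : ℝ)) ^ (z.1 i) /
                ((z.1 i).factorial : ℝ))
      atTop (nhds 0) := by
  set r : Fin n → ℝ → ℝ := fun i x =>
    (m i : ℝ) * x ^ ((i : ℕ) + 1) / (((i : ℕ) + 1).factorial : ℝ)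
  have hr_nonneg : ∀ i x, 0 ≤ x → 0 ≤ r i x := fun i x hx => by positivity
  have hr_tendsto : ∀ i, Tendsto (r i) atTop atTop := fun i =>
    ((tendsto_pow_atTop (Nat.succ_ne_zero _)).const_mul_atTop
      (Nat.cast_pos.2 (hm i))).atTop_div_const (by positivity)
  have hbound : Tendsto (fun x => ∑ j, ∑ k ∈ Finset.range (C j),
      Real.exp (-r j x) * r j x ^ k / (k.factorial : ℝ)) atTop (nhds 0) := by
    rw [← Finset.sum_const_zero (s := (Finset.univ : Finset (Fin n)))]
    refine tendsto_finsetSum _ fun j _ => ?_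
    rw [← Finset.sum_const_zero (s := Finset.range (C j))]
    exact tendsto_finsetSum _ fun k _ =>
      (tendsto_exp_neg_mul_pow_div_factorial_atTop k).comp (hr_tendsto j)
  refine tendsto_of_tendsto_of_tendsto_of_le_of_le' tendsto_const_nhds hbound ?_ ?_
  · filter_upwards [eventually_ge_atTop 0] with x hx
    refine tsum_nonneg fun z => Finset.prod_nonneg fun i _ => ?_
    have := hr_nonneg i x hx
    positivity
  · filter_upwards [eventually_ge_atTop 0] with x hx
    refine tsum_prod_le_sum_sum_range
      (fun i k => Real.exp (-r i x) * r i x ^ k / (k.factorial : ℝ)) (fun i k => ?_)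
      (fun i s => sum_exp_neg_mul_pow_div_factorial_le_one (hr_nonneg i x hx) s) C _
      fun z hz => ?_
    · have := hr_nonneg i x hx
      positivity
    · by_contra! h
      simp [Nat.sub_eq_zero_of_le (h _)] at hz
end

section
/- Let S be a countable set, let μ : S → ℝ be a probability mass function on S (μ ≥ 0 and ∑_{s∈S} μ(s) = 1), let A be a nonempty finite set, and let P ⊆ S × A. For L ⊆ A define PM(L) = ∑_{s ∈ S : (s,a) ∈ P for all a ∈ L} μ(s). Suppose that PM({a}) ≤ 1/|A| for every a ∈ A and that there exists a₀ ∈ A with PM({a₀}) = 0. Then for every subset L ⊆ A, PM(L) ≤ 1 − |L|/|A|. -/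
open scoped BigOperators

/-- Sums of a nonnegative summable function over subtypes are monotone in the subtype. -/
theorem Summable.tsum_subtype_mono {S : Type*} {f : S → ℝ} (hf : Summable f)
    (hf0 : ∀ s, 0 ≤ f s) {p q : S → Prop} (hpq : ∀ s, p s → q s) :
    (∑' s : {s // p s}, f s.1) ≤ ∑' s : {s // q s}, f s.1 :=
  (hf.subtype {s | p s}).tsum_le_tsum_of_inj (Subtype.map id hpq)
    (Subtype.map_injective hpq Function.injective_id) (fun c _ => hf0 c.1)
    (fun _ => le_rfl) (hf.subtype {s | q s})

/-- Verification of Strassen's condition (inequality (13)) from the proof of Theorem 1 of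
the paper: if `μ` is a probability mass function on a countable set `S` of rows, `A` a
nonempty finite set of columns, `P ⊆ S × A` a set of pivots whose single-column pivot
masses are all at most `1/|A|` and at least one of which is `0`, then the pivot mass of
every collection `L` of columns is at most `1 − |L|/|A|`. -/
theorem strassen_condition
    {S A : Type*} [Countable S] [Fintype A] [Nonempty A]
    (μ : S → ℝ) (hμ0 : ∀ s, 0 ≤ μ s) (hμ1 : ∑' s : S, μ s = 1)
    (P : Set (S × A))
    (hcol : ∀ a : A, (∑' s : {s : S // (s, a) ∈ P}, μ s.1) ≤ 1 / (Fintype.card A : ℝ))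
    (hzero : ∃ a₀ : A, (∑' s : {s : S // (s, a₀) ∈ P}, μ s.1) = 0) :
    ∀ L : Finset A,
      (∑' s : {s : S // ∀ a ∈ L, (s, a) ∈ P}, μ s.1) ≤
        1 - (L.card : ℝ) / (Fintype.card A : ℝ) := by
  intro L
  have hsum : Summable μ := by
    by_contra h
    simp [tsum_eq_zero_of_not_summable h] at hμ1
  have hle : ∀ a ∈ L, (∑' s : {s : S // ∀ a ∈ L, (s, a) ∈ P}, μ s.1) ≤
      ∑' s : {s : S // (s, a) ∈ P}, μ s.1 := fun a ha =>
    hsum.tsum_subtype_mono hμ0 fun _ h => h a ha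
  have hcard : (0 : ℝ) < Fintype.card A := by exact_mod_cast Fintype.card_pos
  obtain ⟨a₀, ha₀⟩ := hzero
  rcases L.eq_empty_or_nonempty with rfl | ⟨a, ha⟩
  · rw [Finset.card_empty, Nat.cast_zero, zero_div, sub_zero]
    exact (hsum.tsum_subtype_le μ {s | ∀ a ∈ (∅ : Finset A), (s, a) ∈ P} hμ0).trans hμ1.le
  by_cases hL : a₀ ∈ L
  · refine (hle a₀ hL).trans (ha₀.le.trans (sub_nonneg.2 ((div_le_one hcard).2 ?_)))
    exact_mod_cast L.card_le_univ
  · refine (hle a ha).trans ((hcol a).trans ?_)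
    rw [le_sub_iff_add_le, ← add_div, div_le_one hcard, add_comm]
    exact_mod_cast Finset.card_lt_univ_of_notMem hL
end

section
/- Let n ≥ 1. For a partition λ of n and i ∈ {1,…,n}, let C_i(λ) denote the number of parts of λ equal to i, so that ∑_{i=1}^n i·C_i(λ) = n, and let p(n) denote the number of partitions of n. For x ∈ (0,1), let ν_x be the probability mass function on ℕ^n given by ν_x(z) = ∏_{i=1}^n x^{i·z_i}·(1 − x^i) (the product of independent distributions with P(Z_i = k) = x^{ik}(1 − x^i) for k ∈ ℕ). Then there exists x₀ ∈ (0,1) such that for all x with x₀ < x < 1 there is a function p : ℕ^n × {partitions of n} → ℝ with p ≥ 0, ∑_λ p(z,λ) = ν_x(z) for every z ∈ ℕ^n, ∑_{z∈ℕ^n} p(z,λ) = 1/p(n) for every partition λ of n, and p(z,λ) = 0 whenever ∑_{i=1}^n max(C_i(λ) − z_i, 0) > 1. -/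
open Filter Topology

/-- A finite product of nonnegative series, expanded as a series over functions. -/
theorem hasSum_pi_prod_of_nonneg {n : ℕ} {f : Fin n → ℕ → ℝ} {a : Fin n → ℝ}
    (hf : ∀ i k, 0 ≤ f i k) (h : ∀ i, HasSum (f i) (a i)) :
    HasSum (fun z : Fin n → ℕ => ∏ i, f i (z i)) (∏ i, a i) := by
  induction n with
  | zero => simp
  | succ n ih =>
    have ht := ih (f := fun i => f i.succ) (a := fun i => a i.succ)
      (fun i => hf i.succ) (fun i => h i.succ)
    have hs := (h 0).summable.mul_of_nonneg ht.summable (hf 0)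
      (fun z => Finset.prod_nonneg fun i _ => hf _ _)
    have hp := (h 0).mul ht hs
    rw [← (Fin.consEquiv fun _ : Fin (n + 1) => ℕ).hasSum_iff, Fin.prod_univ_succ]
    refine hp.congr_fun fun z => ?_
    simp [Fin.prod_univ_succ, Fin.consEquiv]

/-- The tail of a geometric distribution. -/
theorem hasSum_geometric_tail {y : ℝ} (hy₀ : 0 ≤ y) (hy₁ : y < 1) (m : ℕ) :
    HasSum (fun k => if m ≤ k then y ^ k * (1 - y) else 0) (y ^ m) := by
  rw [← (add_left_injective m).hasSum_iff]
  · have h := (hasSum_geometric_of_lt_one hy₀ hy₁).mul_right (y ^ m * (1 - y))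
    have hy : (1 - y)⁻¹ * (y ^ m * (1 - y)) = y ^ m := by
      have : 1 - y ≠ 0 := by linarith
      field_simp
    rw [hy] at h
    refine h.congr_fun fun k => ?_
    simp [pow_add, mul_assoc]
  · intro k hk
    refine if_neg fun hmk => hk ⟨k - m, ?_⟩
    simp [hmk]

/-- The total deficit of any `z` relative to the one-part partition is at most one. -/
theorem sum_count_indiscrete_sub_le_one {n : ℕ} (z : Fin n → ℕ) :
    ∑ i : Fin n, ((Nat.Partition.indiscrete n).parts.count ((i : ℕ) + 1) - z i) ≤ 1 := by
  rcases Nat.eq_zero_or_pos n with rfl | hn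
  · simp
  calc ∑ i : Fin n, ((Nat.Partition.indiscrete n).parts.count ((i : ℕ) + 1) - z i)
      ≤ ∑ i : Fin n, if i = ⟨n - 1, by omega⟩ then 1 else 0 := by
        refine Finset.sum_le_sum fun i _ => (Nat.sub_le _ _).trans ?_
        rw [Nat.Partition.indiscrete_parts hn.ne', Multiset.count_singleton]
        split_ifs with h₁ h₂ <;> first | omega | exact absurd (Fin.ext (by simp; omega)) h₂
    _ = 1 := by simp

/-- The multiplicity of a part in a partition of `n` is at most `n`. -/
theorem Nat.Partition.count_le {n : ℕ} (μ : Nat.Partition n) (j : ℕ) : μ.parts.count j ≤ n := by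
  refine (Multiset.count_le_card _ _).trans ?_
  have h := Multiset.card_nsmul_le_sum (s := μ.parts) (a := 1) fun i hi => μ.parts_pos hi
  simpa [μ.parts_sum] using h

/-- A probability mass function `f` dominating `g` can be coupled with the uniform distribution on
a finite type `κ` so that the part `f - g` is sent to a single point `a`, provided that the
total mass of `f - g` is at most that of `a`. -/
theorem exists_coupling_uniform {ι κ : Type*} [Fintype κ] [DecidableEq κ] (a : κ)
    {f g : ι → ℝ} {G : ℝ} (hf : HasSum f 1) (hg : HasSum g G) (hg₀ : ∀ z, 0 ≤ g z)
    (hgf : ∀ z, g z ≤ f z) (hG₀ : 0 < G) (hG : 1 - 1 / (Fintype.card κ : ℝ) ≤ G) :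
    ∃ p : ι × κ → ℝ, (∀ q, 0 ≤ p q) ∧ (∀ z, ∑ b, p (z, b) = f z) ∧
      (∀ b, ∑' z, p (z, b) = 1 / (Fintype.card κ : ℝ)) ∧
      ∀ z b, g z = 0 → b ≠ a → p (z, b) = 0 := by
  have : Nonempty κ := ⟨a⟩
  have hc₀ : 0 ≤ 1 / (Fintype.card κ : ℝ) := by positivity
  have hcard : ∑ _b : κ, 1 / (Fintype.card κ : ℝ) = 1 := by simp
  generalize 1 / (Fintype.card κ : ℝ) = c at *
  let δ (b : κ) : ℝ := if b = a then 1 else 0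
  have hδ : ∑ b, δ b = 1 := by simp [δ]
  have hδ₀ (b) : 0 ≤ δ b := by
    dsimp only [δ]
    split_ifs <;> norm_num
  let w (b : κ) : ℝ := (c - δ b * (1 - G)) / G
  have hw₀ (b) : 0 ≤ w b := by
    refine div_nonneg ?_ hG₀.le
    dsimp only [δ]
    split_ifs <;> linarith
  have hw : ∑ b, w b = 1 := by
    rw [← Finset.sum_div, Finset.sum_sub_distrib, ← Finset.sum_mul, hδ, hcard]
    field_simp
    ring
  refine ⟨fun q => g q.1 * w q.2 + (f q.1 - g q.1) * δ q.2, fun q => ?_, fun z => ?_,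
    fun b => ?_, fun z b hz hb => ?_⟩
  · exact add_nonneg (mul_nonneg (hg₀ _) (hw₀ _))
      (mul_nonneg (sub_nonneg.2 (hgf _)) (hδ₀ _))
  · dsimp only
    rw [Finset.sum_add_distrib, ← Finset.mul_sum, ← Finset.mul_sum, hδ, hw]
    ring
  · rw [((hg.mul_right (w b)).add ((hf.sub hg).mul_right (δ b))).tsum_eq]
    simp only [w]
    field_simp
    ring
  · simp [hz, δ, hb]

/-- The product of the geometric mass functions with ratios `x, x², …, xⁿ`, restricted to the
points all of whose coordinates are at least `m`. -/
noncomputable def geometricTailMass (n : ℕ) (x : ℝ) (m : ℕ) (z : Fin n → ℕ) : ℝ :=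
  ∏ i : Fin n, if m ≤ z i then (x ^ ((i : ℕ) + 1)) ^ z i * (1 - x ^ ((i : ℕ) + 1)) else 0

section geometricTailMass

variable {n : ℕ} {x : ℝ}

theorem geometricTailMass_factor_nonneg (hx₀ : 0 ≤ x) (hx₁ : x ≤ 1) (i k : ℕ) :
    0 ≤ (x ^ (i + 1)) ^ k * (1 - x ^ (i + 1)) :=
  mul_nonneg (by positivity) (sub_nonneg.2 (pow_le_one₀ hx₀ hx₁))

theorem geometricTailMass_nonneg (hx₀ : 0 ≤ x) (hx₁ : x ≤ 1) (m : ℕ) (z : Fin n → ℕ) :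
    0 ≤ geometricTailMass n x m z := by
  refine Finset.prod_nonneg fun i _ => ?_
  split_ifs
  exacts [geometricTailMass_factor_nonneg hx₀ hx₁ _ _, le_rfl]

theorem geometricTailMass_le (hx₀ : 0 ≤ x) (hx₁ : x ≤ 1) (m : ℕ) (z : Fin n → ℕ) :
    geometricTailMass n x m z ≤ geometricTailMass n x 0 z := by
  refine Finset.prod_le_prod (fun i _ => ?_) fun i _ => ?_
  all_goals
    have := geometricTailMass_factor_nonneg hx₀ hx₁ i (z i)
    split_ifs <;> simp_all

theorem hasSum_geometricTailMass (hx₀ : 0 ≤ x) (hx₁ : x < 1) (m : ℕ) :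
    HasSum (geometricTailMass n x m) (∏ i : Fin n, (x ^ ((i : ℕ) + 1)) ^ m) := by
  refine hasSum_pi_prod_of_nonneg (f := fun (i : Fin n) k =>
    if m ≤ k then (x ^ ((i : ℕ) + 1)) ^ k * (1 - x ^ ((i : ℕ) + 1)) else 0)
    (fun i k => ?_) fun i =>
    hasSum_geometric_tail (by positivity) (pow_lt_one₀ hx₀ hx₁ (by omega)) m
  split_ifs
  exacts [geometricTailMass_factor_nonneg hx₀ hx₁.le _ _, le_rfl]

theorem geometricTailMass_zero (z : Fin n → ℕ) :
    geometricTailMass n x 0 z =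
      ∏ i : Fin n, x ^ (((i : ℕ) + 1) * z i) * (1 - x ^ ((i : ℕ) + 1)) := by
  simp [geometricTailMass, pow_mul]

theorem geometricTailMass_eq_zero {m : ℕ} {z : Fin n → ℕ} {i : Fin n} (hi : z i < m) :
    geometricTailMass n x m z = 0 :=
  Finset.prod_eq_zero (Finset.mem_univ i) (if_neg hi.not_ge)

end geometricTailMass

open scoped BigOperators

/-- Theorem 1 of the paper specialized to the multiset `Aₙ` of integer partitions of `n`:
for `x` close enough to `1`, the product geometric-type distribution with
`P(Zᵢ = k) = x^{ik}(1 - xⁱ)` and the uniform distribution on the partitions of `n`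
admit a coupling assigning zero mass to every pivot, where the component counting process
of a partition records the multiplicities of its parts. -/
theorem partition_coupling (n : ℕ) (hn : 1 ≤ n) :
    ∃ x₀ ∈ Set.Ioo (0 : ℝ) 1, ∀ x, x₀ < x → x < 1 →
      ∃ p : (Fin n → ℕ) × Nat.Partition n → ℝ,
        (∀ q, 0 ≤ p q) ∧
        (∀ z : Fin n → ℕ, ∑ μ : Nat.Partition n, p (z, μ) =
          ∏ i : Fin n, x ^ (((i : ℕ) + 1) * z i) * (1 - x ^ ((i : ℕ) + 1))) ∧
        (∀ μ : Nat.Partition n, ∑' z : Fin n → ℕ, p (z, μ) =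
          1 / (Fintype.card (Nat.Partition n) : ℝ)) ∧
        (∀ z : Fin n → ℕ, ∀ μ : Nat.Partition n,
          1 < ∑ i : Fin n, (μ.parts.count ((i : ℕ) + 1) - z i) → p (z, μ) = 0) := by
  have hev : ∀ᶠ x in 𝓝[<] (1 : ℝ), 1 - 1 / (Fintype.card (Nat.Partition n) : ℝ) <
      ∏ i : Fin n, (x ^ ((i : ℕ) + 1)) ^ n := by
    have hcont : Continuous fun x : ℝ => ∏ i : Fin n, (x ^ ((i : ℕ) + 1)) ^ n := by fun_prop
    refine nhdsWithin_le_nhds (hcont.continuousAt.eventually_const_lt ?_)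
    have : 0 < Fintype.card (Nat.Partition n) := Fintype.card_pos
    simpa using this
  obtain ⟨l, hl, hlG⟩ := (mem_nhdsLT_iff_exists_Ioo_subset' (zero_lt_one' ℝ)).1 hev
  have hl₁ : l < 1 := hl
  refine ⟨max l (1 / 2), ⟨by positivity, max_lt hl₁ (by norm_num)⟩, fun x hx hx₁ => ?_⟩
  have hx₀ : 0 < x := by linarith [le_max_right l (1 / 2)]
  have hGc := hlG ⟨(le_max_left _ _).trans_lt hx, hx₁⟩
  have hf : HasSum (geometricTailMass n x 0) 1 := by
    simpa using hasSum_geometricTailMass (n := n) hx₀.le hx₁ 0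
  obtain ⟨p, hp₀, hp₁, hp₂, hp₃⟩ := exists_coupling_uniform (Nat.Partition.indiscrete n) hf
    (hasSum_geometricTailMass hx₀.le hx₁ n) (geometricTailMass_nonneg hx₀.le hx₁.le n)
    (geometricTailMass_le hx₀.le hx₁.le n) (by positivity) (le_of_lt hGc)
  refine ⟨p, hp₀, fun z => (hp₁ z).trans (geometricTailMass_zero z), hp₂, fun z μ hzμ => ?_⟩
  have hz : ∃ i, z i < n := by
    by_contra! h
    rw [Finset.sum_eq_zero fun i _ =>
      Nat.sub_eq_zero_of_le ((μ.count_le _).trans (h i))] at hzμ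
    omega
  obtain ⟨i, hi⟩ := hz
  refine hp₃ z μ (geometricTailMass_eq_zero hi) ?_
  rintro rfl
  exact (sum_count_indiscrete_sub_le_one z).not_gt hzμ
end
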